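/- arXiv:2504.10516 — 2 statements merged into one kernel-verified Lean document; each statement's English description precedes it below -/
import Mathlib

section
/- For any odd integer d ≥ 3, each phase-space point operator A^u (u ∈ (ZMod d)²) is Hermitian with Tr[A^u] = 1, and the family is orthogonal: Tr[A^u A^v] = d if u = v and Tr[A^u A^v] = 0 if u ≠ v. -/
open Matrix

noncomputable section

/-- ω = exp(2πi/d). -/
def wUnit (d : ℕ) : ℂ := Complex.exp (2 * (Real.pi : ℂ) * Complex.I / d)

/-- τ = exp((d+1)πi/d). -/
def tUnit (d : ℕ) : ℂ := Complex.exp (((d : ℂ) + 1) * (Real.pi : ℂ) * Complex.I / d)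

/-- The shift operator, X|k⟩ = |k+1⟩. -/
def shiftX (d : ℕ) : Matrix (ZMod d) (ZMod d) ℂ :=
  Matrix.of fun i j => if i = j + 1 then 1 else 0

/-- The clock operator, Z|k⟩ = ω^k |k⟩. -/
def clockZ (d : ℕ) : Matrix (ZMod d) (ZMod d) ℂ :=
  Matrix.of fun i j => if i = j then wUnit d ^ j.val else 0

/-- The Heisenberg-Weyl operator T_u = τ^{-a₁a₂} Z^{a₁} X^{a₂}. -/
def HW (d : ℕ) [NeZero d] (u : ZMod d × ZMod d) : Matrix (ZMod d) (ZMod d) ℂ :=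
  tUnit d ^ (-(u.1 * u.2)).val • (clockZ d ^ (u.1).val * shiftX d ^ (u.2).val)

/-- The phase space point operator at the origin, A^0 = (1/d) Σ_u T_u. -/
def A0 (d : ℕ) [NeZero d] : Matrix (ZMod d) (ZMod d) ℂ :=
  (1 / (d : ℂ)) • ∑ u : ZMod d × ZMod d, HW d u

/-- The phase space point operator A^u = T_u A^0 (T_u)†. -/
def Apt (d : ℕ) [NeZero d] (u : ZMod d × ZMod d) : Matrix (ZMod d) (ZMod d) ℂ :=
  HW d u * A0 d * (HW d u)ᴴ

open ZMod in
/-- The additive character of `ZMod d` realises the powers of `ω`. -/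
theorem wUnit_pow (d : ℕ) [NeZero d] (n : ℕ) : wUnit d ^ n = stdAddChar (n : ZMod d) := by
  have h := stdAddChar_coe (N := d) n
  rw [Int.cast_natCast] at h
  rw [h, wUnit, ← Complex.exp_nat_mul]
  congr 1
  push_cast
  ring

/-- `2` is inverted in `ZMod d` by `(d + 1) / 2` when `d` is odd. -/
theorem two_mul_half_succ {d : ℕ} (hodd : Odd d) :
    (2 : ZMod d) * (((d + 1) / 2 : ℕ) : ZMod d) = 1 := by
  have h : 2 * ((d + 1) / 2) = d + 1 := Nat.two_mul_div_two_of_even hodd.add_one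
  have hcast := congrArg (Nat.cast : ℕ → ZMod d) h
  push_cast at hcast
  simpa using hcast

open ZMod in
/-- The powers of `τ` are values of the standard character at multiples of `1/2`. -/
theorem tUnit_pow {d : ℕ} [NeZero d] (hodd : Odd d) (n : ℕ) :
    tUnit d ^ n = stdAddChar ((((d + 1) / 2 : ℕ) : ZMod d) * (n : ZMod d)) := by
  have h : 2 * ((d + 1) / 2) = d + 1 := Nat.two_mul_div_two_of_even hodd.add_one
  have hcast := congrArg (Nat.cast : ℕ → ℂ) h
  have : tUnit d = wUnit d ^ ((d + 1) / 2) := by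
    rw [tUnit, wUnit, ← Complex.exp_nat_mul]
    congr 1
    simp only [Nat.cast_mul, Nat.cast_add, Nat.cast_one, Nat.cast_ofNat] at hcast
    rw [← hcast]
    ring
  rw [this, ← pow_mul, wUnit_pow, Nat.cast_mul]

theorem shiftX_pow_apply (d : ℕ) [NeZero d] (n : ℕ) (i j : ZMod d) :
    (shiftX d ^ n) i j = if i = j + n then 1 else 0 := by
  induction n generalizing i j with
  | zero => simp [Matrix.one_apply]
  | succ n ih =>
    rw [pow_succ, Matrix.mul_apply]
    simp only [ih]
    simp [shiftX, add_assoc, add_comm (1 : ZMod d)]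

theorem clockZ_eq_diagonal (d : ℕ) :
    clockZ d = Matrix.diagonal fun j : ZMod d => wUnit d ^ j.val := by
  ext i j
  by_cases h : i = j <;> simp [clockZ, h]

open ZMod in
theorem HW_apply {d : ℕ} [NeZero d] (hodd : Odd d) (u : ZMod d × ZMod d) (i j : ZMod d) :
    HW d u i j = if i = j + u.2 then
      stdAddChar (u.1 * i - (((d + 1) / 2 : ℕ) : ZMod d) * (u.1 * u.2)) else 0 := by
  rw [HW, Matrix.smul_apply, clockZ_eq_diagonal, Matrix.diagonal_pow, Matrix.diagonal_mul,
    shiftX_pow_apply, tUnit_pow hodd, Pi.pow_apply, ← pow_mul, wUnit_pow, Nat.cast_mul]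
  simp only [natCast_val, cast_id', id, smul_eq_mul, mul_ite, mul_one, mul_zero]
  split_ifs
  · rw [← AddChar.map_add_eq_mul]
    congr 1
    ring
  · rfl

open ZMod in
/-- Orthogonality relation for the standard character. -/
theorem sum_stdAddChar_mul (d : ℕ) [NeZero d] (b : ZMod d) :
    ∑ x : ZMod d, stdAddChar (x * b) = if b = 0 then (d : ℂ) else 0 := by
  have h := AddChar.sum_mulShift b (isPrimitive_stdAddChar d)
  rw [ZMod.card] at h
  rw [h]
  split_ifs <;> simp

/-- The phase-space point operator at the origin is the parity operator. -/
theorem A0_apply {d : ℕ} [NeZero d] (hodd : Odd d) (i j : ZMod d) :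
    A0 d i j = if i = -j then 1 else 0 := by
  have h2 := two_mul_half_succ hodd
  set c : ZMod d := (((d + 1) / 2 : ℕ) : ZMod d) with hc
  have hsum : ∑ u : ZMod d × ZMod d, HW d u i j =
      ∑ x : ZMod d, ZMod.stdAddChar (x * (i - c * (i - j))) := by
    rw [Fintype.sum_prod_type]
    refine Finset.sum_congr rfl fun x _ => ?_
    rw [Finset.sum_eq_single (i - j)]
    · rw [HW_apply hodd, if_pos (by simp), ← hc]
      congr 1
      ring
    · intro y _ hy
      rw [HW_apply hodd, if_neg]
      rintro rfl
      exact hy (by simp)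
    · simp
  have hiff : i - c * (i - j) = 0 ↔ i = -j := by
    constructor
    · intro h
      linear_combination 2 * h + (i - j) * h2
    · rintro rfl
      linear_combination j * h2
  rw [A0, Matrix.smul_apply, Matrix.sum_apply, hsum, sum_stdAddChar_mul]
  simp [hiff, NeZero.ne]

theorem two_mul_cancel {d : ℕ} (hodd : Odd d) {a b : ZMod d} : 2 * a = 2 * b ↔ a = b := by
  refine ⟨fun h => ?_, fun h => by rw [h]⟩
  linear_combination (((d + 1) / 2 : ℕ) : ZMod d) * h - (a - b) * two_mul_half_succ hodd

open ZMod in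
theorem Apt_apply {d : ℕ} [NeZero d] (hodd : Odd d) (u : ZMod d × ZMod d) (i j : ZMod d) :
    Apt d u i j = if i = 2 * u.2 - j then stdAddChar (u.1 * (i - j)) else 0 := by
  rw [Apt, Matrix.mul_apply, Finset.sum_eq_single (j - u.2)]
  · rw [Matrix.mul_apply, Finset.sum_eq_single (i - u.2)]
    · rw [Matrix.conjTranspose_apply, HW_apply hodd, HW_apply hodd,
        if_pos (by ring), if_pos (by ring), A0_apply hodd]
      have hiff : i - u.2 = -(j - u.2) ↔ i = 2 * u.2 - j :=
        ⟨fun h => by linear_combination h, fun h => by linear_combination h⟩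
      simp only [hiff]
      split_ifs
      · rw [mul_one, ← starRingEnd_apply, ← AddChar.map_neg_eq_conj, ← AddChar.map_add_eq_mul]
        congr 1
        ring
      · simp
    · intro k _ hk
      rw [HW_apply hodd, if_neg, zero_mul]
      rintro rfl
      exact hk (by ring)
    · simp
  · intro l _ hl
    rw [Matrix.conjTranspose_apply, HW_apply hodd, if_neg, star_zero, mul_zero]
    rintro rfl
    exact hl (by ring)
  · simp

theorem Apt_isHermitian {d : ℕ} [NeZero d] (hodd : Odd d) (u : ZMod d × ZMod d) :
    (Apt d u).IsHermitian := by
  ext i j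
  rw [Matrix.conjTranspose_apply, Apt_apply hodd, Apt_apply hodd]
  have hiff : j = 2 * u.2 - i ↔ i = 2 * u.2 - j :=
    ⟨fun h => by linear_combination h, fun h => by linear_combination h⟩
  simp only [hiff]
  split_ifs
  · rw [← starRingEnd_apply, ← AddChar.map_neg_eq_conj]
    congr 1
    ring
  · simp

theorem Apt_trace {d : ℕ} [NeZero d] (hodd : Odd d) (u : ZMod d × ZMod d) :
    (Apt d u).trace = 1 := by
  have hiff (i : ZMod d) : i = 2 * u.2 - i ↔ i = u.2 := by
    rw [eq_sub_iff_add_eq, ← two_mul, two_mul_cancel hodd]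
  simp [Matrix.trace, Apt_apply hodd, hiff]

theorem Apt_mul_Apt_trace {d : ℕ} [NeZero d] (hodd : Odd d) (u v : ZMod d × ZMod d) :
    (Apt d u * Apt d v).trace = if u = v then (d : ℂ) else 0 := by
  have hentry (j : ZMod d) : (∑ i, Apt d u i j * Apt d v j i) = if u.2 = v.2 then
      ZMod.stdAddChar (2 * (u.1 - v.1) * u.2) * ZMod.stdAddChar (j * (2 * (v.1 - u.1))) else 0 := by
    rw [Finset.sum_eq_single (2 * u.2 - j)]
    · have hiff : j = 2 * v.2 - (2 * u.2 - j) ↔ u.2 = v.2 := by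
        rw [← two_mul_cancel hodd (a := u.2)]
        exact ⟨fun h => by linear_combination h, fun h => by linear_combination h⟩
      rw [Apt_apply hodd, Apt_apply hodd, if_pos rfl]
      simp only [hiff]
      split_ifs
      · rw [← AddChar.map_add_eq_mul, ← AddChar.map_add_eq_mul]
        congr 1
        ring
      · simp
    · intro i _ hi
      rw [Apt_apply hodd, if_neg hi, zero_mul]
    · simp
  have htrace : (Apt d u * Apt d v).trace = ∑ j, ∑ i, Apt d u i j * Apt d v j i := by
    rw [Finset.sum_comm]
    simp [Matrix.trace, Matrix.mul_apply]
  have hiff : 2 * (v.1 - u.1) = 0 ↔ u.1 = v.1 := by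
    rw [← mul_zero (2 : ZMod d), two_mul_cancel hodd, sub_eq_zero, eq_comm]
  rw [htrace, Finset.sum_congr rfl fun j _ => hentry j]
  by_cases h2 : u.2 = v.2
  · simp only [h2, if_true]
    rw [← Finset.mul_sum, sum_stdAddChar_mul]
    by_cases h1 : u.1 = v.1
    · simp [Prod.ext_iff, h1, h2]
    · simp [Prod.ext_iff, hiff, h1]
  · simp [Prod.ext_iff, h2]

/-- Each phase-space point operator is Hermitian with unit trace, and the family
is orthogonal: Tr[A^u A^v] = d·δ(u,v). -/
theorem phase_space_point_operators_hermitian_trace_orthogonal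
    (d : ℕ) [NeZero d] (hd : 3 ≤ d) (hodd : Odd d) :
    (∀ u : ZMod d × ZMod d, (Apt d u).IsHermitian) ∧
    (∀ u : ZMod d × ZMod d, (Apt d u).trace = 1) ∧
    (∀ u v : ZMod d × ZMod d, (Apt d u * Apt d v).trace = if u = v then (d : ℂ) else 0) := by
  exact ⟨Apt_isHermitian hodd, Apt_trace hodd, Apt_mul_Apt_trace hodd⟩
end
end

section
/- For every integer d ≥ 2 and every real δ, the trace of λ₀·R^{T₃} − Q^{T₃} + C^{T₃} equals t = (d−1)(1−δ)(d² + 2d(δ−1)δ − 2δ²)/d²; moreover t ≥ 0 whenever δ ∈ [0,1]. -/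
open Matrix

noncomputable section

/-- Index type for (ℂ^d)^{⊗3}. -/
abbrev Idx (d : ℕ) := Fin 3 → Fin d

/-- The operator on (ℂ^d)^{⊗3} permuting the tensor factors according to c ∈ S₃:
P(c)(v₁⊗v₂⊗v₃) = v_{c⁻¹(1)}⊗v_{c⁻¹(2)}⊗v_{c⁻¹(3)}. -/
def Perm3 (d : ℕ) (c : Equiv.Perm (Fin 3)) : Matrix (Idx d) (Idx d) ℂ :=
  Matrix.of fun i j => if ∀ k, i k = j (c⁻¹ k) then 1 else 0

/-- The projector onto the symmetric subspace of (ℂ^d)^{⊗3}. -/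
def projSym3 (d : ℕ) : Matrix (Idx d) (Idx d) ℂ :=
  ((6 : ℂ))⁻¹ • ∑ c : Equiv.Perm (Fin 3), Perm3 d c

/-- The depolarizing map 𝒟_δ applied to tensor factor s of an operator on (ℂ^d)^{⊗3}. -/
def depOn (d : ℕ) (δ : ℝ) (s : Fin 3) (M : Matrix (Idx d) (Idx d) ℂ) :
    Matrix (Idx d) (Idx d) ℂ :=
  Matrix.of fun i j => (1 - (δ : ℂ)) * M i j +
    ((δ : ℂ) / d) *
      (if i s = j s then ∑ k : Fin d, M (Function.update i s k) (Function.update j s k) else 0)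

/-- D(n,d) = binom(n+d−1, n), the dimension of the symmetric subspace. -/
def Dnd (n d : ℕ) : ℕ := Nat.choose (n + d - 1) n

/-- Q = (𝒟_δ⊗𝒟_δ⊗id)(Π₃)/D(3,d). -/
def Qop (d : ℕ) (δ : ℝ) : Matrix (Idx d) (Idx d) ℂ :=
  ((Dnd 3 d : ℂ))⁻¹ • depOn d δ 0 (depOn d δ 1 (projSym3 d))

/-- R = ((𝒟_δ⊗𝒟_δ)(Π₂)/D(2,d)) ⊗ I_d, using Π₂ ⊗ I = (I + P((12)))/2 on (ℂ^d)^{⊗3}. -/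
def Rop (d : ℕ) (δ : ℝ) : Matrix (Idx d) (Idx d) ℂ :=
  ((Dnd 2 d : ℂ))⁻¹ •
    depOn d δ 0 (depOn d δ 1 (((2 : ℂ))⁻¹ • (1 + Perm3 d (Equiv.swap 0 1))))

/-- The partial transpose on the third tensor factor:
(M^{T₃})_{(i₁i₂i₃),(j₁j₂j₃)} = M_{(i₁i₂j₃),(j₁j₂i₃)}. -/
def pt3 (d : ℕ) (M : Matrix (Idx d) (Idx d) ℂ) : Matrix (Idx d) (Idx d) ℂ :=
  Matrix.of fun i j => M (Function.update i 2 (j 2)) (Function.update j 2 (i 2))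

theorem trace_pt3 (d : ℕ) (M : Matrix (Idx d) (Idx d) ℂ) : (pt3 d M).trace = M.trace := by
  simp [Matrix.trace, pt3]

theorem sum_sum_update {ι κ A : Type*} [Fintype ι] [DecidableEq ι] [Fintype κ]
    [AddCommMonoid A] (s : ι) (F : (ι → κ) → A) :
    ∑ i : ι → κ, ∑ k : κ, F (Function.update i s k) = Fintype.card κ • ∑ i, F i := by
  have hinv : Function.Involutive
      (fun p : (ι → κ) × κ => (Function.update p.1 s p.2, p.1 s)) := fun p => by simp
  rw [← Fintype.sum_prod_type' fun i k => F (Function.update i s k),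
    Fintype.sum_equiv hinv.toPerm (fun p => F (Function.update p.1 s p.2)) (fun p => F p.1)
      (fun p => rfl), Fintype.sum_prod_type]
  simp [Finset.smul_sum]

/-- The depolarizing map preserves the trace. -/
theorem trace_depOn {d : ℕ} (hd : d ≠ 0) (δ : ℝ) (s : Fin 3) (M : Matrix (Idx d) (Idx d) ℂ) :
    (depOn d δ s M).trace = M.trace := by
  have hd' : (d : ℂ) ≠ 0 := Nat.cast_ne_zero.mpr hd
  have h := sum_sum_update s (fun i : Idx d => M i i)
  simp only [Fintype.card_fin, nsmul_eq_mul] at h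
  simp only [Matrix.trace, Matrix.diag_apply, depOn, Matrix.of_apply, if_true,
    Finset.sum_add_distrib, ← Finset.mul_sum, h]
  field_simp
  ring

theorem sum_idx {d : ℕ} {A : Type*} [AddCommMonoid A] (F : Idx d → A) :
    ∑ i, F i = ∑ a, ∑ b, ∑ c, F ![a, b, c] := by
  rw [← (Fin.consEquiv fun _ : Fin 3 => Fin d).sum_comp, Fintype.sum_prod_type]
  refine Finset.sum_congr rfl fun a _ => ?_
  rw [← (finTwoArrowEquiv (Fin d)).symm.sum_comp, Fintype.sum_prod_type]
  rfl

theorem trace_Perm3 (d : ℕ) (c : Equiv.Perm (Fin 3)) :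
    (Perm3 d c).trace = ∑ x, ∑ y, ∑ z,
      if ∀ k : Fin 3, (![x, y, z] : Idx d) k = (![x, y, z] : Idx d) (c⁻¹ k) then (1 : ℂ) else 0 := by
  simp only [Matrix.trace, Matrix.diag_apply, Perm3, Matrix.of_apply, sum_idx]

theorem trace_Perm3_one (d : ℕ) : (Perm3 d 1).trace = (d : ℂ) ^ 3 := by
  simp [trace_Perm3]
  ring

theorem trace_Perm3_swap01 (d : ℕ) : (Perm3 d (Equiv.swap 0 1)).trace = (d : ℂ) ^ 2 := by
  have h (x y z : Fin d) : (∀ k : Fin 3, (![x, y, z] : Idx d) k =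
      (![x, y, z] : Idx d) ((Equiv.swap 0 1)⁻¹ k)) ↔ x = y := by
    simp [Fin.forall_fin_succ, Equiv.swap_apply_def, eq_comm]
  simp only [trace_Perm3, h]
  simp
  ring

theorem trace_Perm3_swap02 (d : ℕ) : (Perm3 d (Equiv.swap 0 2)).trace = (d : ℂ) ^ 2 := by
  have h (x y z : Fin d) : (∀ k : Fin 3, (![x, y, z] : Idx d) k =
      (![x, y, z] : Idx d) ((Equiv.swap 0 2)⁻¹ k)) ↔ x = z := by
    simp [Fin.forall_fin_succ, Equiv.swap_apply_def, eq_comm]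
  simp only [trace_Perm3, h]
  simp
  ring

theorem trace_Perm3_swap12 (d : ℕ) : (Perm3 d (Equiv.swap 1 2)).trace = (d : ℂ) ^ 2 := by
  have h (x y z : Fin d) : (∀ k : Fin 3, (![x, y, z] : Idx d) k =
      (![x, y, z] : Idx d) ((Equiv.swap 1 2)⁻¹ k)) ↔ y = z := by
    simp [Fin.forall_fin_succ, Equiv.swap_apply_def, eq_comm]
  simp only [trace_Perm3, h]
  simp
  ring

theorem trace_Perm3_inv (d : ℕ) (c : Equiv.Perm (Fin 3)) :
    (Perm3 d c⁻¹).trace = (Perm3 d c).trace := by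
  have h (i : Idx d) : (∀ k, i k = i (c⁻¹⁻¹ k)) ↔ ∀ k, i k = i (c⁻¹ k) := by
    rw [← c⁻¹.forall_congr_right]
    simp [eq_comm]
  simp only [Matrix.trace, Matrix.diag_apply, Perm3, Matrix.of_apply, h]

theorem trace_Perm3_finRotate (d : ℕ) : (Perm3 d (finRotate 3)).trace = (d : ℂ) := by
  have h (x y z : Fin d) : (∀ k : Fin 3, (![x, y, z] : Idx d) k =
      (![x, y, z] : Idx d) ((finRotate 3)⁻¹⁻¹ k)) ↔ x = y ∧ x = z := by
    simp [Fin.forall_fin_succ]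
    grind
  rw [← trace_Perm3_inv]
  simp only [trace_Perm3, h, ite_and]
  simp

theorem trace_projSym3 (d : ℕ) :
    (projSym3 d).trace = (d : ℂ) * (d + 1) * (d + 2) / 6 := by
  have h : (Finset.univ : Finset (Equiv.Perm (Fin 3))) =
      {1, Equiv.swap 0 1, Equiv.swap 0 2, Equiv.swap 1 2, finRotate 3, (finRotate 3)⁻¹} := by
    decide
  have hsum : ∑ c : Equiv.Perm (Fin 3), (Perm3 d c).trace =
      (d : ℂ) ^ 3 + (d ^ 2 + (d ^ 2 + (d ^ 2 + (d + d)))) := by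
    rw [h, Finset.sum_insert (by decide), Finset.sum_insert (by decide),
      Finset.sum_insert (by decide), Finset.sum_insert (by decide),
      Finset.sum_insert (by decide), Finset.sum_singleton, trace_Perm3_one, trace_Perm3_swap01,
      trace_Perm3_swap02, trace_Perm3_swap12, trace_Perm3_inv, trace_Perm3_finRotate]
  rw [projSym3, Matrix.trace_smul, Matrix.trace_sum, hsum, smul_eq_mul]
  ring

theorem cast_Dnd_two (d : ℕ) : (Dnd 2 d : ℂ) = d * (d + 1) / 2 := by
  have h : 2 + d - 1 = d + 1 := by lia
  rw [Dnd, h, Nat.cast_choose_two]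
  push_cast
  ring

theorem cast_Dnd_three (d : ℕ) : (Dnd 3 d : ℂ) = d * (d + 1) * (d + 2) / 6 := by
  have h : 3 + d - 1 = d + 2 := by lia
  have h3 := Nat.descFactorial_eq_factorial_mul_choose (d + 2) 3
  have h4 : (d + 2).descFactorial 3 = d * ((d + 1) * (d + 2)) := by
    simp [Nat.descFactorial]
  rw [h4] at h3
  have h5 : (d : ℂ) * ((d + 1) * (d + 2)) = 6 * ((d + 2).choose 3 : ℂ) := by
    exact_mod_cast h3
  rw [Dnd, h, mul_assoc, h5]
  ring

theorem trace_Qop {d : ℕ} (hd : d ≠ 0) (δ : ℝ) : (Qop d δ).trace = 1 := by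
  have h : (d : ℂ) * (d + 1) * (d + 2) / 6 ≠ 0 := by
    have : ((d * (d + 1) * (d + 2) : ℕ) : ℂ) ≠ 0 := Nat.cast_ne_zero.mpr (by positivity)
    push_cast at this
    exact div_ne_zero this (by norm_num)
  rw [Qop, Matrix.trace_smul, trace_depOn hd, trace_depOn hd, trace_projSym3, cast_Dnd_three,
    smul_eq_mul, inv_mul_cancel₀ h]

theorem trace_one_idx (d : ℕ) : (1 : Matrix (Idx d) (Idx d) ℂ).trace = (d : ℂ) ^ 3 := by
  simp [Matrix.trace_one]

theorem trace_Rop {d : ℕ} (hd : d ≠ 0) (δ : ℝ) : (Rop d δ).trace = d := by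
  have h0 : (d : ℂ) ≠ 0 := Nat.cast_ne_zero.mpr hd
  have h1 : (d : ℂ) + 1 ≠ 0 := Nat.cast_add_one_ne_zero d
  rw [Rop, Matrix.trace_smul, trace_depOn hd, trace_depOn hd, Matrix.trace_smul,
    Matrix.trace_add, trace_one_idx, trace_Perm3_swap01, cast_Dnd_two, smul_eq_mul, smul_eq_mul]
  field_simp

/-- The trace of λ₀·R^{T₃} − Q^{T₃} + C^{T₃} equals
t = (d−1)(1−δ)(d² + 2d(δ−1)δ − 2δ²)/d², and t ≥ 0 whenever δ ∈ [0,1]. -/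
theorem trace_lam0_R_sub_Q_add_C_pt3
    (d : ℕ) (hd : 2 ≤ d) (δ : ℝ) (α t : ℝ)
    (hα : α = (1 - δ) * δ * ((d : ℝ) * (δ - 1) - δ) / ((d : ℝ) ^ 3 * ((d : ℝ) + 1)))
    (ht : t = ((d : ℝ) - 1) * (1 - δ) * ((d : ℝ) ^ 2 + 2 * (d : ℝ) * (δ - 1) * δ - 2 * δ ^ 2)
        / (d : ℝ) ^ 2) :
    ((1 - ((d : ℝ) - 1) * δ / d) • pt3 d (Rop d δ) - pt3 d (Qop d δ)
      + pt3 d ((2 * α) • (1 : Matrix (Idx d) (Idx d) ℂ)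
          - α • (Perm3 d (finRotate 3) + Perm3 d (finRotate 3)⁻¹))).trace = (t : ℂ) ∧
    (δ ∈ Set.Icc (0 : ℝ) 1 → 0 ≤ t) := by
  have hd0 : d ≠ 0 := by lia
  constructor
  · have h0 : (d : ℂ) ≠ 0 := Nat.cast_ne_zero.mpr hd0
    have h1 : (d : ℂ) + 1 ≠ 0 := Nat.cast_add_one_ne_zero d
    simp only [Matrix.trace_add, Matrix.trace_sub, Matrix.trace_smul, trace_pt3, trace_Rop hd0,
      trace_Qop hd0, trace_one_idx, trace_Perm3_inv, trace_Perm3_finRotate, hα, ht,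
      Complex.real_smul]
    push_cast
    field_simp
    ring
  · rintro ⟨hδ0, hδ1⟩
    have hd2 : (2 : ℝ) ≤ d := by exact_mod_cast hd
    have h : 0 ≤ (d : ℝ) ^ 2 + 2 * (d : ℝ) * (δ - 1) * δ - 2 * δ ^ 2 := by
      nlinarith [mul_nonneg hδ0 (sub_nonneg.mpr hδ1), sq_nonneg (δ - 1 / 2),
        mul_nonneg (sub_nonneg.mpr hd2) (sq_nonneg (δ - 1 / 2))]
    rw [ht]
    exact div_nonneg (mul_nonneg (mul_nonneg (by linarith) (by linarith)) h) (sq_nonneg _)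
end
end
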